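/- Let 𝒜 be a unital C*-algebra, let A and B be positive invertible elements of 𝒜, and let r ∈ (-1,0). Then A♯_r B = ∫₀¹ (sin((r+1)π)/π) · s^{r} (1-s)^{-(r+1)} · ((1-s)·A^{-1}BA^{-1} + s·A^{-1})^{-1} ds, where the integral is a Bochner integral over (0,1). -/

import Mathlib

open scoped NNReal

variable {𝒜 : Type*} [CStarAlgebra 𝒜] [PartialOrder 𝒜] [StarOrderedRing 𝒜]

/-- The `r`-weighted geometric mean of positive invertible elements of a unital C*-algebra:
`A♯ᵣB = A^(1/2) (A^(-1/2) B A^(-1/2))^r A^(1/2)`, real powers taken via the continuous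
functional calculus. -/
noncomputable def sharp (A B : 𝒜) (r : ℝ) : 𝒜 :=
  CFC.rpow A (1 / 2 : ℝ) *
    CFC.rpow (CFC.rpow A (-(1 / 2) : ℝ) * B * CFC.rpow A (-(1 / 2) : ℝ)) r *
      CFC.rpow A (1 / 2 : ℝ)


open MeasureTheory in
lemma beta_int (r : ℝ) (hr : r ∈ Set.Ioo (-1 : ℝ) 0) :
    ∫ s in Set.Ioo (0 : ℝ) 1, s ^ r * (1 - s) ^ (-(r + 1)) =
      Real.pi / Real.sin ((r + 1) * Real.pi) := by
  have h1 : 0 < r + 1 := by linarith [hr.1]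
  have h2 : 0 < -r := by linarith [hr.2]
  have h := ProbabilityTheory.beta_eq_betaIntegralReal (r + 1) (-r) h1 h2
  have hc : IntervalIntegrable (fun x : ℝ => (x : ℂ) ^ (((r + 1 : ℝ) : ℂ) - 1) *
      (1 - (x : ℂ)) ^ (((-r : ℝ) : ℂ) - 1)) volume 0 1 :=
    Complex.betaIntegral_convergent (by simpa using h1) (by simpa using hr.2)
  rw [intervalIntegrable_iff_integrableOn_Ioc_of_le (by simp), IntegrableOn] at hc
  rw [Complex.betaIntegral, intervalIntegral.integral_of_le (by norm_num),
    ← RCLike.re_to_complex, ← integral_re hc, integral_Ioc_eq_integral_Ioo] at h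
  have h3 : ∫ s in Set.Ioo (0 : ℝ) 1, s ^ r * (1 - s) ^ (-(r + 1)) =
      ProbabilityTheory.beta (r + 1) (-r) := by
    rw [h]
    refine setIntegral_congr_fun measurableSet_Ioo fun x ⟨hx1, hx2⟩ ↦ ?_
    norm_cast
    rw [← Complex.ofReal_cpow, ← Complex.ofReal_cpow, RCLike.re_to_complex,
      Complex.re_mul_ofReal, Complex.ofReal_re]
    · congr 2 <;> ring
    all_goals linarith
  rw [h3, ProbabilityTheory.beta, show r + 1 + -r = 1 by ring, Real.Gamma_one, div_one,
    show -r = 1 - (r + 1) by ring, Real.Gamma_mul_Gamma_one_sub, mul_comm]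

lemma sin_pos_aux (r : ℝ) (hr : r ∈ Set.Ioo (-1 : ℝ) 0) :
    0 < Real.sin ((r + 1) * Real.pi) := by
  have := Real.pi_pos
  apply Real.sin_pos_of_pos_of_lt_pi
  · have : 0 < r + 1 := by linarith [hr.1]
    positivity
  · nlinarith [hr.2]

open MeasureTheory in
lemma beta_integrable (r : ℝ) (hr : r ∈ Set.Ioo (-1 : ℝ) 0) :
    IntegrableOn (fun s : ℝ => s ^ r * (1 - s) ^ (-(r + 1))) (Set.Ioo (0 : ℝ) 1) := by
  by_contra h
  have h1 := beta_int r hr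
  rw [integral_undef h] at h1
  have := div_pos Real.pi_pos (sin_pos_aux r hr)
  linarith

open MeasureTheory in
lemma scalar_int (r : ℝ) (hr : r ∈ Set.Ioo (-1 : ℝ) 0) (x : ℝ) (hx : 0 < x) :
    ∫ s in Set.Ioo (0 : ℝ) 1, (Real.sin ((r + 1) * Real.pi) / Real.pi * s ^ r *
      (1 - s) ^ (-(r + 1))) * ((1 - s) * x + s)⁻¹ = x ^ r := by
  have hD : ∀ v ∈ Set.Ioo (0 : ℝ) 1, 0 < 1 - v + x * v := fun v hv => by
    have := mul_pos hx hv.1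
    linarith [hv.2]
  have him : (fun v : ℝ => x * v / (1 - v + x * v)) '' Set.Ioo (0 : ℝ) 1 = Set.Ioo (0 : ℝ) 1 := by
    ext s
    constructor
    · rintro ⟨v, hv, rfl⟩
      have := hD v hv
      refine ⟨div_pos (mul_pos hx hv.1) this, ?_⟩
      show x * v / (1 - v + x * v) < 1
      rw [div_lt_one this]
      linarith [hv.2]
    · rintro ⟨h0, h1⟩
      have hE : 0 < s + x * (1 - s) := by
        have := mul_pos hx (sub_pos.2 h1)
        linarith
      refine ⟨s / (s + x * (1 - s)), ⟨div_pos h0 hE, ?_⟩, ?_⟩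
      · rw [div_lt_one hE]
        have := mul_pos hx (sub_pos.2 h1)
        linarith
      · show x * (s / (s + x * (1 - s))) / (1 - s / (s + x * (1 - s)) + x * (s / (s + x * (1 - s)))) = s
        have : (1 - s / (s + x * (1 - s)) + x * (s / (s + x * (1 - s)))) = x / (s + x * (1 - s)) := by
          field_simp
          ring
        rw [this]
        field_simp
  have hinj : Set.InjOn (fun v : ℝ => x * v / (1 - v + x * v)) (Set.Ioo (0 : ℝ) 1) := by
    intro a ha b hb hab
    have h1 := hD a ha
    have h2 := hD b hb
    simp only at hab
    rw [div_eq_div_iff h1.ne' h2.ne'] at hab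
    have : x * (a - b) = 0 := by linear_combination hab
    rcases mul_eq_zero.1 this with h | h
    · exact absurd h hx.ne'
    · linarith
  have hder : ∀ v ∈ Set.Ioo (0 : ℝ) 1, HasDerivWithinAt (fun v : ℝ => x * v / (1 - v + x * v))
      (x / (1 - v + x * v) ^ 2) (Set.Ioo (0 : ℝ) 1) v := by
    intro v hv
    have h1 := hD v hv
    have ha : HasDerivAt (fun v : ℝ => x * v) x v := by
      simpa using (hasDerivAt_id v).const_mul x
    have hb : HasDerivAt (fun v : ℝ => 1 - v + x * v) (-1 + x) v := by
      exact ((hasDerivAt_id' v).const_sub 1).add ha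
    have hd : HasDerivAt (fun v : ℝ => x * v / (1 - v + x * v)) _ v := ha.div hb h1.ne'
    have hval : x / (1 - v + x * v) ^ 2 =
        (x * (1 - v + x * v) - x * v * (-1 + x)) / (1 - v + x * v) ^ 2 := by
      congr 1
      ring
    rw [hval]
    exact hd.hasDerivWithinAt
  have key := integral_image_eq_integral_abs_deriv_smul measurableSet_Ioo hder hinj
    (fun s => (Real.sin ((r + 1) * Real.pi) / Real.pi * s ^ r *
      (1 - s) ^ (-(r + 1))) * ((1 - s) * x + s)⁻¹)
  rw [him] at key
  rw [key]
  have hs := sin_pos_aux r hr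
  have hp := Real.pi_pos
  calc _ = ∫ v in Set.Ioo (0 : ℝ) 1, (Real.sin ((r + 1) * Real.pi) / Real.pi * x ^ r) *
        (v ^ r * (1 - v) ^ (-(r + 1))) := by
        refine setIntegral_congr_fun measurableSet_Ioo fun v hv ↦ ?_
        have h1 := hD v hv
        have hv1 : 0 < 1 - v := sub_pos.2 hv.2
        have e1 : 1 - x * v / (1 - v + x * v) = (1 - v) / (1 - v + x * v) := by
          field_simp
          ring
        simp only [smul_eq_mul]
        rw [e1, abs_of_pos (by positivity), Real.div_rpow (mul_pos hx hv.1).le h1.le,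
          Real.div_rpow hv1.le h1.le, Real.mul_rpow hx.le hv.1.le]
        have e2 : (1 - v) / (1 - v + x * v) * x + x * v / (1 - v + x * v)
            = x / (1 - v + x * v) := by
          field_simp
          ring
        rw [e2]
        set D := 1 - v + x * v
        have e3 : D ^ (-(r + 1)) = (D ^ r * D)⁻¹ := by
          rw [Real.rpow_neg h1.le, Real.rpow_add h1, Real.rpow_one]
        rw [e3]
        have := Real.rpow_pos_of_pos h1 r
        field_simp
    _ = x ^ r := by
        rw [integral_const_mul, beta_int r hr]
        field_simp

section
variable {𝒜 : Type*} [CStarAlgebra 𝒜] [PartialOrder 𝒜] [StarOrderedRing 𝒜]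

lemma cfc_resolvent (X : 𝒜) (hX : IsStrictlyPositive X) (c s : ℝ) (hs : s ∈ Set.Ioo (0 : ℝ) 1) :
    cfc (fun z : ℝ => c * ((1 - s) * z + s)⁻¹) X =
      c • Ring.inverse ((1 - s) • X + s • (1 : 𝒜)) := by
  have hsa : IsSelfAdjoint X := hX.isSelfAdjoint
  have hne : ∀ z ∈ spectrum ℝ X, (1 - s) * z + s ≠ 0 := fun z hz => by
    have := mul_pos (sub_pos.2 hs.2) (hX.spectrum_pos hz)
    linarith [hs.1]
  rw [cfc_const_mul c (fun z : ℝ => ((1 - s) * z + s)⁻¹) X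
    (ContinuousOn.inv₀ (by fun_prop) hne), cfc_inv (fun z : ℝ => (1 - s) * z + s) X hne,
    cfc_add_const s (fun z : ℝ => (1 - s) * z) X, cfc_const_mul_id (1 - s) X,
    Algebra.algebraMap_eq_smul_one]

open MeasureTheory in
lemma rpow_integral (X : 𝒜) (hX : IsStrictlyPositive X) (r : ℝ) (hr : r ∈ Set.Ioo (-1 : ℝ) 0) :
    IntegrableOn (fun s : ℝ => (Real.sin ((r + 1) * Real.pi) / Real.pi * s ^ r *
        (1 - s) ^ (-(r + 1))) • Ring.inverse ((1 - s) • X + s • (1 : 𝒜))) (Set.Ioo (0 : ℝ) 1) ∧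
    CFC.rpow X r = ∫ s in Set.Ioo (0 : ℝ) 1, (Real.sin ((r + 1) * Real.pi) / Real.pi * s ^ r *
        (1 - s) ^ (-(r + 1))) • Ring.inverse ((1 - s) • X + s • (1 : 𝒜)) := by
  have hsa : IsSelfAdjoint X := hX.isSelfAdjoint
  obtain ⟨m, hm, hm1, hmz⟩ : ∃ m : ℝ, 0 < m ∧ m ≤ 1 ∧ ∀ z ∈ spectrum ℝ X, m ≤ z := by
    rcases (spectrum ℝ X).eq_empty_or_nonempty with h | h
    · exact ⟨1, one_pos, le_rfl, by simp [h]⟩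
    · obtain ⟨m, hm, hmin⟩ := (spectrum.isCompact (𝕜 := ℝ) X).exists_isLeast h
      exact ⟨min m 1, lt_min (hX.spectrum_pos hm) one_pos, min_le_right _ _,
        fun z hz => (min_le_left _ _).trans (hmin hz)⟩
  have hsin := sin_pos_aux r hr
  have hp := Real.pi_pos
  set f : ℝ → ℝ → ℝ := fun s z => (Real.sin ((r + 1) * Real.pi) / Real.pi * s ^ r *
        (1 - s) ^ (-(r + 1))) * ((1 - s) * z + s)⁻¹ with hf
  set bound : ℝ → ℝ := fun s => (Real.sin ((r + 1) * Real.pi) / Real.pi * m⁻¹) *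
    (s ^ r * (1 - s) ^ (-(r + 1))) with hb
  have hge : ∀ s ∈ Set.Ioo (0 : ℝ) 1, ∀ z ∈ spectrum ℝ X, m ≤ (1 - s) * z + s := by
    intro s hs z hz
    nlinarith [mul_le_mul_of_nonneg_left (hmz z hz) (sub_pos.2 hs.2).le, hs.1]
  have hcont : ContinuousOn (Function.uncurry f) (Set.Ioo (0 : ℝ) 1 ×ˢ spectrum ℝ X) := by
    rintro ⟨s, z⟩ ⟨hs, hz⟩
    apply ContinuousAt.continuousWithinAt
    have h1 : (1 - s) * z + s ≠ 0 := (hm.trans_le (hge s hs z hz)).ne'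
    have h2 : s ≠ 0 := hs.1.ne'
    have h3 : 1 - s ≠ 0 := (sub_pos.2 hs.2).ne'
    simp only [hf, Function.uncurry_def]
    refine ((continuousAt_const.mul (continuousAt_fst.rpow_const (Or.inl h2))).mul
      ((continuousAt_const.sub continuousAt_fst).rpow_const (Or.inl h3))).mul
      (ContinuousAt.inv₀ (by fun_prop) h1)
  have hbd : ∀ᵐ s ∂(volume.restrict (Set.Ioo (0 : ℝ) 1)), ∀ z ∈ spectrum ℝ X,
      ‖f s z‖ ≤ bound s := by
    refine ae_restrict_of_forall_mem measurableSet_Ioo fun s hs z hz => ?_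
    have h1 := hge s hs z hz
    have h2 := Real.rpow_pos_of_pos hs.1 r
    have h3 := Real.rpow_pos_of_pos (sub_pos.2 hs.2) (-(r + 1))
    have h4 : 0 < (1 - s) * z + s := hm.trans_le h1
    rw [Real.norm_of_nonneg (by positivity)]
    calc f s z ≤ (Real.sin ((r + 1) * Real.pi) / Real.pi * s ^ r *
        (1 - s) ^ (-(r + 1))) * m⁻¹ := by
          simp only [hf]
          gcongr
      _ = bound s := by simp only [hb]; ring
  have hbi : HasFiniteIntegral bound (volume.restrict (Set.Ioo (0 : ℝ) 1)) :=
    ((beta_integrable r hr).const_mul _).2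
  have hcongr : Set.EqOn (fun s => cfc (f s) X) (fun s : ℝ =>
      (Real.sin ((r + 1) * Real.pi) / Real.pi * s ^ r *
        (1 - s) ^ (-(r + 1))) • Ring.inverse ((1 - s) • X + s • (1 : 𝒜))) (Set.Ioo (0 : ℝ) 1) :=
    fun s hs => cfc_resolvent X hX _ s hs
  constructor
  · exact (integrableOn_cfc measurableSet_Ioo f bound X hcont hbd hbi hsa).congr_fun hcongr
      measurableSet_Ioo
  · rw [← setIntegral_congr_fun measurableSet_Ioo hcongr,
      ← cfc_setIntegral measurableSet_Ioo f bound X hcont hbd hbi hsa]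
    refine (CFC.rpow_eq_cfc_real hX.nonneg).trans (cfc_congr fun z hz => ?_)
    exact (scalar_int r hr z (hX.spectrum_pos hz)).symm

lemma inverse_conj (P Q Y : 𝒜) (h1 : P * Q = 1) (h2 : Q * P = 1) (hY : IsUnit Y) :
    Ring.inverse (Q * Y * Q) = P * Ring.inverse Y * P := by
  obtain ⟨u, rfl⟩ := hY
  let q : 𝒜ˣ := ⟨Q, P, h2, h1⟩
  have : Q * (u : 𝒜) * Q = ((q * u * q : 𝒜ˣ) : 𝒜) := rfl
  rw [this, Ring.inverse_unit, Ring.inverse_unit, mul_inv_rev, mul_inv_rev, ← mul_assoc]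
  rfl
end

/-- Theorem 2.6: integral representation of `A♯ᵣB` for `r ∈ (-1,0)`. -/
theorem stmt_9 (A B : 𝒜) (hA : 0 ≤ A) (hA' : IsUnit A) (hB : 0 ≤ B) (hB' : IsUnit B)
    (r : ℝ) (hr : r ∈ Set.Ioo (-1 : ℝ) 0) :
    sharp A B r = ∫ s in Set.Ioo (0 : ℝ) 1,
      (Real.sin ((r + 1) * Real.pi) / Real.pi * s ^ r * (1 - s) ^ (-(r + 1))) •
        Ring.inverse ((1 - s) • (Ring.inverse A * B * Ring.inverse A) +
          s • Ring.inverse A) := by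
  have hAp : IsStrictlyPositive A := ⟨hA, hA'⟩
  have hPQ : CFC.rpow A (1 / 2 : ℝ) * CFC.rpow A (-(1 / 2) : ℝ) = 1 :=
    CFC.rpow_mul_rpow_neg (1 / 2) hAp
  have hQP : CFC.rpow A (-(1 / 2) : ℝ) * CFC.rpow A (1 / 2 : ℝ) = 1 :=
    CFC.rpow_neg_mul_rpow (1 / 2) hAp
  have hQQ : Ring.inverse A = CFC.rpow A (-(1 / 2) : ℝ) * CFC.rpow A (-(1 / 2) : ℝ) := by
    rw [CFC.inverse_eq_rpow_neg_one hAp]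
    refine Eq.trans ?_ (CFC.rpow_add (x := -(1 / 2)) (y := -(1 / 2)) hA')
    norm_num
  have hQ0 : 0 ≤ CFC.rpow A (-(1 / 2) : ℝ) := CFC.rpow_nonneg
  unfold sharp
  rw [hQQ]
  generalize CFC.rpow A (-(1 / 2) : ℝ) = Q at *
  generalize CFC.rpow A (1 / 2 : ℝ) = P at *
  have hQu : IsUnit Q := ⟨⟨Q, P, hQP, hPQ⟩, rfl⟩
  have hX : IsStrictlyPositive (Q * B * Q) := by
    refine ⟨?_, (hQu.mul hB').mul hQu⟩
    exact (IsSelfAdjoint.of_nonneg hQ0).conjugate_nonneg hB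
  obtain ⟨hi, he⟩ := rpow_integral (Q * B * Q) hX r hr
  rw [he, ← integral_const_mul_of_integrable hi,
    ← integral_mul_const_of_integrable (hi.const_mul P)]
  refine MeasureTheory.setIntegral_congr_fun measurableSet_Ioo fun s hs => ?_
  have hY : IsUnit ((1 - s) • (Q * B * Q) + s • (1 : 𝒜)) := by
    have h1 : IsStrictlyPositive (s • (1 : 𝒜)) := IsStrictlyPositive.smul hs.1 isStrictlyPositive_one
    exact (IsStrictlyPositive.nonneg_add (smul_nonneg (sub_pos.2 hs.2).le hX.nonneg) h1).isUnit
  have e : (1 - s) • (Q * Q * B * (Q * Q)) + s • (Q * Q) =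
      Q * ((1 - s) • (Q * B * Q) + s • (1 : 𝒜)) * Q := by
    simp only [mul_add, add_mul, mul_smul_comm, smul_mul_assoc, mul_one, mul_assoc]
  rw [e, inverse_conj P Q _ hPQ hQP hY, mul_smul_comm, smul_mul_assoc]
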